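/- arXiv:2204.03624 — 4 statements merged into one kernel-verified Lean document; each statement's English description precedes it below -/
import Mathlib

section
/- Let n ≥ 1 and let X ∈ M(n,ℍ) with tr(Φ(X)) = 0 be such that Φ(X) ∈ M(2n,ℂ) is diagonalizable (X is semisimple) and X is Ad_{SL(n,ℍ)}-real. Then X is strongly Ad_{SL(n,ℍ)}-real if and only if for every nonzero purely imaginary μ ∈ ℂ (μ.re = 0, μ ≠ 0), the ℂ-dimension of the kernel of Φ(X) − μ·1 is even. -/
/-- The embedding Φ : M(n,ℍ) → M(2n,ℂ), written as a block matrix. -/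
noncomputable def Phi {m : Type*} [Fintype m] [DecidableEq m]
    (A : Matrix m m (Quaternion ℝ)) : Matrix (m ⊕ m) (m ⊕ m) ℂ :=
  Matrix.fromBlocks
    (Matrix.of fun k l => (⟨(A k l).re, (A k l).imI⟩ : ℂ))
    (Matrix.of fun k l => (⟨(A k l).imJ, (A k l).imK⟩ : ℂ))
    (-(Matrix.of fun k l => (starRingEnd ℂ) (⟨(A k l).imJ, (A k l).imK⟩ : ℂ)))
    (Matrix.of fun k l => (starRingEnd ℂ) (⟨(A k l).re, (A k l).imI⟩ : ℂ))

/-- The ℂ-dimension of the kernel of (the linear map associated to) a complex matrix. -/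
noncomputable def kerDim {m : Type*} [Fintype m] (Y : Matrix m m ℂ) : ℕ :=
  Module.finrank ℂ (LinearMap.ker Y.mulVecLin)


open Matrix

section RingTheory

variable {R : Type*} [Ring R]

lemma mul_eq_zero_of_mul_left_right {x y e f : R} (hx : x * e = x) (hy : f * y = y)
    (hef : e * f = 0) : x * y = 0 := by
  rw [← hx, ← hy, mul_assoc, ← mul_assoc e, hef, zero_mul, mul_zero]

/-- A sum of two mutually inverse pairs of partial isomorphisms between the summands of an
orthogonal decomposition of the identity, and of the identity on the last one, is an involution. -/
lemma mul_self_eq_one_of_partial_inverses {e₁ e₂ e₀ f₁ f₂ a b c d : R}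
    (hsum : e₁ + e₂ + e₀ + f₁ + f₂ = 1)
    (h_e₁e₂ : e₁ * e₂ = 0) (h_e₂e₁ : e₂ * e₁ = 0) (h_e₁e₀ : e₁ * e₀ = 0) (h_e₀e₁ : e₀ * e₁ = 0)
    (h_e₁f₁ : e₁ * f₁ = 0) (h_f₁e₁ : f₁ * e₁ = 0) (h_e₁f₂ : e₁ * f₂ = 0) (h_f₂e₁ : f₂ * e₁ = 0)
    (h_e₂e₀ : e₂ * e₀ = 0) (h_e₀e₂ : e₀ * e₂ = 0) (h_e₂f₁ : e₂ * f₁ = 0) (h_f₁e₂ : f₁ * e₂ = 0)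
    (h_e₂f₂ : e₂ * f₂ = 0) (h_f₂e₂ : f₂ * e₂ = 0) (h_e₀f₁ : e₀ * f₁ = 0) (h_f₁e₀ : f₁ * e₀ = 0)
    (h_e₀f₂ : e₀ * f₂ = 0) (h_f₂e₀ : f₂ * e₀ = 0) (h_f₁f₂ : f₁ * f₂ = 0) (h_f₂f₁ : f₂ * f₁ = 0)
    (he₀ : e₀ * e₀ = e₀)
    (ha : a * e₁ = a) (ha' : e₂ * a = a) (hb : b * e₂ = b) (hb' : e₁ * b = b)
    (hc : c * f₂ = c) (hc' : f₁ * c = c) (hd : d * f₁ = d) (hd' : f₂ * d = d)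
    (hab : a * b = e₂) (hba : b * a = e₁) (hcd : c * d = f₁) (hdc : d * c = f₂) :
    (a + b + e₀ + c + d) * (a + b + e₀ + c + d) = 1 := by
  have z {x y e f : R} (hx : x * e = x) (hy : f * y = y) (hef : e * f = 0) : x * y = 0 :=
    mul_eq_zero_of_mul_left_right hx hy hef
  simp only [add_mul, mul_add, hab, hba, hcd, hdc, he₀,
    z ha ha' h_e₁e₂, z ha he₀ h_e₁e₀, z ha hc' h_e₁f₁, z ha hd' h_e₁f₂,
    z hb hb' h_e₂e₁, z hb he₀ h_e₂e₀, z hb hc' h_e₂f₁, z hb hd' h_e₂f₂,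
    z he₀ ha' h_e₀e₂, z he₀ hb' h_e₀e₁, z he₀ hc' h_e₀f₁, z he₀ hd' h_e₀f₂,
    z hc ha' h_f₂e₂, z hc hb' h_f₂e₁, z hc he₀ h_f₂e₀, z hc hc' h_f₂f₁,
    z hd ha' h_f₁e₂, z hd hb' h_f₁e₁, z hd he₀ h_f₁e₀, z hd hd' h_f₁f₂]
  rw [← hsum]
  abel

end RingTheory

section SpectralCalculus

variable {ι : Type*} [Fintype ι] [DecidableEq ι]

/-- The functional calculus `f ↦ f(A)` of the diagonalizable matrix `A = P * diagonal D * P⁻¹`. -/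
noncomputable def diagCalc (P : Matrix ι ι ℂ) (D : ι → ℂ) (f : ℂ → ℂ) : Matrix ι ι ℂ :=
  P * diagonal (fun i => f (D i)) * P⁻¹

variable {P Q : Matrix ι ι ℂ} {D D' : ι → ℂ}

lemma diagCalc_mul (hP : IsUnit P) (f g : ℂ → ℂ) :
    diagCalc P D f * diagCalc P D g = diagCalc P D (fun z => f z * g z) := by
  have h : P⁻¹ * P = 1 := nonsing_inv_mul P ((isUnit_iff_isUnit_det P).1 hP)
  calc _ = P * diagonal (fun i => f (D i)) * (P⁻¹ * P) * diagonal (fun i => g (D i)) * P⁻¹ := by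
        simp only [diagCalc, Matrix.mul_assoc]
    _ = _ := by rw [h, Matrix.mul_one, Matrix.mul_assoc P, diagonal_mul_diagonal, diagCalc]

lemma diagCalc_add (f g : ℂ → ℂ) :
    diagCalc P D f + diagCalc P D g = diagCalc P D (fun z => f z + g z) := by
  simp only [diagCalc, ← Matrix.add_mul, ← Matrix.mul_add, diagonal_add]

lemma diagCalc_one (hP : IsUnit P) : diagCalc P D (fun _ => 1) = 1 := by
  simp [diagCalc, mul_nonsing_inv P ((isUnit_iff_isUnit_det P).1 hP)]

lemma diagCalc_zero : diagCalc P D (fun _ => 0) = 0 := by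
  simp [diagCalc]

/-- An intertwiner of two diagonalizable matrices intertwines their functional calculi. -/
lemma mul_diagCalc_comm (hP : IsUnit P) (hQ : IsUnit Q) {Y : Matrix ι ι ℂ}
    (h : Y * (P * diagonal D * P⁻¹) = Q * diagonal D' * Q⁻¹ * Y) (f : ℂ → ℂ) :
    Y * diagCalc P D f = diagCalc Q D' f * Y := by
  have hP' : P * P⁻¹ = 1 := mul_nonsing_inv P ((isUnit_iff_isUnit_det P).1 hP)
  have hP'' : P⁻¹ * P = 1 := nonsing_inv_mul P ((isUnit_iff_isUnit_det P).1 hP)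
  have hQ' : Q * Q⁻¹ = 1 := mul_nonsing_inv Q ((isUnit_iff_isUnit_det Q).1 hQ)
  have hQ'' : Q⁻¹ * Q = 1 := nonsing_inv_mul Q ((isUnit_iff_isUnit_det Q).1 hQ)
  have hZ : (Q⁻¹ * Y * P) * diagonal D = diagonal D' * (Q⁻¹ * Y * P) := by
    calc _ = Q⁻¹ * (Y * (P * diagonal D * P⁻¹)) * P := by
          simp only [Matrix.mul_assoc, hP'', Matrix.mul_one]
      _ = (Q⁻¹ * Q) * diagonal D' * (Q⁻¹ * Y * P) := by rw [h]; simp only [Matrix.mul_assoc]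
      _ = _ := by rw [hQ'', Matrix.one_mul]
  have hf : (Q⁻¹ * Y * P) * diagonal (fun i => f (D i))
      = diagonal (fun i => f (D' i)) * (Q⁻¹ * Y * P) := by
    ext i j
    have hij := congrFun (congrFun hZ i) j
    rw [mul_diagonal, diagonal_mul] at hij ⊢
    by_cases hz : (Q⁻¹ * Y * P) i j = 0
    · rw [hz]; ring
    · have : D j = D' i := mul_left_cancel₀ hz (by rw [hij]; ring)
      rw [this]; ring
  calc Y * diagCalc P D f = (Q * Q⁻¹) * Y * diagCalc P D f := by rw [hQ', Matrix.one_mul]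
    _ = Q * ((Q⁻¹ * Y * P) * diagonal (fun i => f (D i))) * P⁻¹ := by
        simp only [diagCalc, Matrix.mul_assoc]
    _ = diagCalc Q D' f * Y * (P * P⁻¹) := by rw [hf]; simp only [diagCalc, Matrix.mul_assoc]
    _ = _ := by rw [hP', Matrix.mul_one]

lemma kerDim_diag_sub_smul (hP : IsUnit P) (μ : ℂ) :
    kerDim (P * diagonal D * P⁻¹ - μ • 1) = Fintype.card {i // D i = μ} := by
  have hd : IsUnit P.det := (isUnit_iff_isUnit_det P).1 hP
  have h : P * diagonal D * P⁻¹ - μ • 1 = P * diagonal (fun i => D i - μ) * P⁻¹ := by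
    rw [← diagonal_sub, Matrix.mul_sub, Matrix.sub_mul, ← smul_one_eq_diagonal, mul_smul_comm,
      smul_mul_assoc, Matrix.mul_one, mul_nonsing_inv P hd]
  have hr : (P * diagonal (fun i => D i - μ) * P⁻¹).rank = Fintype.card {i // D i - μ ≠ 0} := by
    rw [rank_mul_eq_left_of_isUnit_det _ _ (by simpa using hd),
      rank_mul_eq_right_of_isUnit_det _ _ hd, rank_diagonal]
  have hrk := LinearMap.finrank_range_add_finrank_ker
    (P * diagonal (fun i => D i - μ) * P⁻¹).mulVecLin
  rw [← Matrix.rank, hr, Module.finrank_fintype_fun_eq_card] at hrk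
  have hc := Fintype.card_subtype_compl (fun i => D i - μ = 0)
  have hle := Fintype.card_subtype_le (fun i => D i - μ = 0)
  have he : Fintype.card {i // D i = μ} = Fintype.card {i // D i - μ = 0} :=
    Fintype.card_congr (Equiv.subtypeEquivRight fun i => sub_eq_zero.symm)
  rw [h, kerDim, he]
  simp only [ne_eq] at hrk
  omega

end SpectralCalculus

section Combinatorics

lemma exists_signed_involution_of_even (F : Type*) [Fintype F] (h : Even (Fintype.card F)) :
    ∃ (τ : F → F) (ε : F → ℝ), ∀ i, τ (τ i) = i ∧ ε (τ i) * ε i = -1 := by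
  obtain ⟨k, hk⟩ := h
  have e : F ≃ Fin k ⊕ Fin k := Fintype.equivOfCardEq (by simpa using hk)
  refine ⟨fun i => e.symm (e i).swap, fun i => Sum.elim (fun _ => 1) (fun _ => -1) (e i),
    fun i => ⟨by simp, ?_⟩⟩
  rcases h : e i <;> simp [h]

/-- If all fibres of `D` over `S` have even cardinality, there is a real matrix that preserves the
fibres and squares to `-1` on those over `S`. -/
lemma exists_fibrewise_sqrt_neg_one {ι α : Type*} [Fintype ι] [DecidableEq ι] [DecidableEq α]
    (D : ι → α) (S : α → Prop) [DecidablePred S]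
    (h : ∀ a, S a → Even (Fintype.card {i // D i = a})) :
    ∃ T : Matrix ι ι ℂ, T.map (starRingEnd ℂ) = T ∧
      T * T = -diagonal (fun i => if S (D i) then 1 else 0) ∧
      ∀ i j, T i j ≠ 0 → D i = D j ∧ S (D i) := by
  have key : ∀ a, ∃ (τ : ι → ι) (ε : ι → ℝ), S a → ∀ i, D i = a →
      D (τ i) = a ∧ τ (τ i) = i ∧ ε (τ i) * ε i = -1 := by
    intro a
    by_cases ha : S a
    · obtain ⟨τ, ε, hτ⟩ := exists_signed_involution_of_even _ (h a ha)
      refine ⟨fun i => if hi : D i = a then τ ⟨i, hi⟩ else i,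
        fun i => if hi : D i = a then ε ⟨i, hi⟩ else 0, fun _ i hi => ?_⟩
      have hp := (τ ⟨i, hi⟩).2
      have := hτ ⟨i, hi⟩
      simp [hi, hp, this.1, this.2]
    · exact ⟨id, 0, fun h => absurd h ha⟩
  choose τ ε hτ using key
  refine ⟨of fun i j => if S (D i) ∧ j = τ (D i) i then (ε (D i) i : ℂ) else 0, ?_, ?_, ?_⟩
  · ext i j
    simp only [map_apply, of_apply]
    split_ifs <;> simp
  · ext i k
    simp only [mul_apply, of_apply, ite_mul, zero_mul]
    by_cases hi : S (D i)
    · obtain ⟨h₁, h₂, h₃⟩ := hτ (D i) hi i rfl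
      rw [Finset.sum_eq_single (τ (D i) i)]
      · simp only [hi, h₁, h₂, true_and, if_true, Matrix.neg_apply]
        by_cases hik : k = i
        · subst hik
          rw [if_pos rfl, diagonal_apply_eq, if_pos hi, ← Complex.ofReal_mul, mul_comm, h₃]
          simp
        · simp [hik, diagonal_apply_ne' _ hik]
      · intro j _ hj; simp [hj]
      · simp
    · simp only [hi, false_and, if_false, Finset.sum_const_zero, Matrix.neg_apply]
      by_cases hik : i = k
      · subst hik; simp [hi]
      · simp [hik]
  · intro i j hij
    simp only [of_apply, ne_eq, ite_eq_right_iff, Classical.not_imp] at hij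
    obtain ⟨⟨hS, rfl⟩, -⟩ := hij
    exact ⟨(hτ _ hS i rfl).1.symm, hS⟩

end Combinatorics

section QuaternionicStructure

variable {ι : Type*} [Fintype ι]

/-- A complex subspace stable under an antilinear map squaring to `-1` is even-dimensional. -/
lemma even_finrank_of_antilinear_sq_eq_neg_one (W : Submodule ℂ (ι → ℂ)) (B : Matrix ι ι ℂ)
    (hW : ∀ v ∈ W, B *ᵥ star v ∈ W) (hB : ∀ v ∈ W, B *ᵥ star (B *ᵥ star v) = -v) :
    Even (Module.finrank ℂ W) := by
  let b := Module.finBasis ℂ W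
  let T : W →ₛₗ[starRingEnd ℂ] W :=
    { toFun := fun v => ⟨B *ᵥ star v.1, hW v v.2⟩
      map_add' := fun v w => by ext1; simp [mulVec_add]
      map_smul' := fun c v => by ext1; simp [mulVec_smul] }
  have hT : ∀ v, T (T v) = -v := fun v => Subtype.ext (hB v v.2)
  let M : Matrix (Fin (Module.finrank ℂ W)) (Fin (Module.finrank ℂ W)) ℂ :=
    of fun i j => b.repr (T (b j)) i
  have hM : M * (starRingEnd ℂ).mapMatrix M = -1 := by
    ext k j
    have h₁ : T (b j) = ∑ i, M i j • b i := (b.sum_repr (T (b j))).symm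
    have h₂ := hT (b j)
    rw [h₁, map_sum] at h₂
    have h₃ := congrArg (fun w => b.repr w k) h₂
    simp only [LinearMap.map_smulₛₗ, map_sum, map_smul, map_neg, Finsupp.coe_finsetSum,
      Finset.sum_apply, Finsupp.smul_apply, Finsupp.neg_apply, smul_eq_mul, b.repr_self] at h₃
    rw [mul_apply, Matrix.neg_apply, one_apply]
    rw [Finsupp.single_apply] at h₃
    simp only [eq_comm (a := k), ← h₃, RingHom.mapMatrix_apply, map_apply]
    exact Finset.sum_congr rfl fun i _ => mul_comm _ _
  have hdet := congrArg det hM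
  rw [det_mul, ← RingHom.map_det, Complex.mul_conj, det_neg, det_one, mul_one,
    Fintype.card_fin] at hdet
  by_contra hodd
  rw [Nat.not_even_iff_odd] at hodd
  rw [hodd.neg_one_pow] at hdet
  have h' : Complex.normSq M.det = -1 := by exact_mod_cast hdet
  linarith [Complex.normSq_nonneg M.det]

variable {m : Type*} [Fintype m] [DecidableEq m]

/-- The conjugation of `M(2n, ℂ)` whose fixed points are the image of `Phi`. -/
noncomputable def quatConj (Y : Matrix (m ⊕ m) (m ⊕ m) ℂ) : Matrix (m ⊕ m) (m ⊕ m) ℂ :=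
  -(J m ℂ * Y.map (starRingEnd ℂ) * J m ℂ)

lemma J_mul_J_mul (Y : Matrix (m ⊕ m) (m ⊕ m) ℂ) : J m ℂ * (J m ℂ * Y) = -Y := by
  rw [← Matrix.mul_assoc, J_squared, Matrix.neg_mul, Matrix.one_mul]

omit [Fintype m] in
lemma J_map_conj : (J m ℂ).map (starRingEnd ℂ) = J m ℂ := map_J _ _

omit [Fintype ι] in
lemma conj_map_conj (Y : Matrix ι ι ℂ) : (Y.map (starRingEnd ℂ)).map (starRingEnd ℂ) = Y := by
  ext; simp

lemma J_mul_conj (Y : Matrix (m ⊕ m) (m ⊕ m) ℂ) :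
    J m ℂ * Y.map (starRingEnd ℂ) = quatConj Y * J m ℂ := by
  rw [quatConj, Matrix.neg_mul, Matrix.mul_assoc, J_squared, Matrix.mul_neg, neg_neg,
    Matrix.mul_one]

lemma quatConj_mul (Y Z : Matrix (m ⊕ m) (m ⊕ m) ℂ) :
    quatConj (Y * Z) = quatConj Y * quatConj Z := by
  simp only [quatConj, Matrix.map_mul, Matrix.mul_assoc, Matrix.neg_mul, Matrix.mul_neg,
    J_mul_J_mul, neg_neg]

lemma quatConj_add (Y Z : Matrix (m ⊕ m) (m ⊕ m) ℂ) :
    quatConj (Y + Z) = quatConj Y + quatConj Z := by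
  have : (Y + Z).map (starRingEnd ℂ) = Y.map (starRingEnd ℂ) + Z.map (starRingEnd ℂ) := by
    ext; simp
  simp only [quatConj, this, Matrix.mul_add, Matrix.add_mul, neg_add]

lemma quatConj_neg (Y : Matrix (m ⊕ m) (m ⊕ m) ℂ) : quatConj (-Y) = -quatConj Y := by
  have : (-Y).map (starRingEnd ℂ) = -Y.map (starRingEnd ℂ) := by ext; simp
  simp only [quatConj, this, Matrix.mul_neg, Matrix.neg_mul]

lemma quatConj_one : quatConj (1 : Matrix (m ⊕ m) (m ⊕ m) ℂ) = 1 := by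
  simp [quatConj, J_squared]

lemma quatConj_quatConj (Y : Matrix (m ⊕ m) (m ⊕ m) ℂ) : quatConj (quatConj Y) = Y := by
  have : (-(J m ℂ * Y.map (starRingEnd ℂ) * J m ℂ)).map (starRingEnd ℂ)
      = -(J m ℂ * Y * J m ℂ) := by
    rw [Matrix.map_neg _ (map_neg _), Matrix.map_mul, Matrix.map_mul, conj_map_conj, J_map_conj]
  rw [quatConj, quatConj, this]
  simp only [Matrix.mul_assoc, Matrix.mul_neg, J_mul_J_mul, neg_neg, J_squared, Matrix.mul_one]

lemma quatConj_fromBlocks (A B C E : Matrix m m ℂ) :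
    quatConj (fromBlocks A B C E) = fromBlocks (E.map (starRingEnd ℂ)) (-C.map (starRingEnd ℂ))
      (-B.map (starRingEnd ℂ)) (A.map (starRingEnd ℂ)) := by
  simp [quatConj, J, fromBlocks_map, fromBlocks_multiply, fromBlocks_neg]

lemma quatConj_Phi (A : Matrix m m (Quaternion ℝ)) : quatConj (Phi A) = Phi A := by
  rw [Phi, quatConj_fromBlocks]
  congr 1 <;> ext <;> simp

lemma exists_Phi_eq {Y : Matrix (m ⊕ m) (m ⊕ m) ℂ} (h : quatConj Y = Y) :
    ∃ A : Matrix m m (Quaternion ℝ), Phi A = Y := by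
  refine ⟨of fun k l => ⟨(Y (.inl k) (.inl l)).re, (Y (.inl k) (.inl l)).im,
    (Y (.inl k) (.inr l)).re, (Y (.inl k) (.inr l)).im⟩, ?_⟩
  rw [← fromBlocks_toBlocks Y, quatConj_fromBlocks, fromBlocks_inj] at h
  conv_rhs => rw [← fromBlocks_toBlocks Y]
  rw [Phi, ← h.2.2.1, ← h.2.2.2]
  congr 1

lemma Phi_injective : Function.Injective (Phi (m := m)) := by
  intro A B h
  simp only [Phi, fromBlocks_inj] at h
  ext k l
  · exact congrArg Complex.re (congrFun (congrFun h.1 k) l)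
  · exact congrArg Complex.im (congrFun (congrFun h.1 k) l)
  · exact congrArg Complex.re (congrFun (congrFun h.2.1 k) l)
  · exact congrArg Complex.im (congrFun (congrFun h.2.1 k) l)

lemma Phi_one : Phi (1 : Matrix m m (Quaternion ℝ)) = 1 := by
  rw [Phi, ← fromBlocks_one]
  congr 1 <;> ext k l <;> by_cases h : k = l <;>
    simp [h, one_apply, Complex.ext_iff] <;> exact ⟨rfl, rfl⟩

lemma Phi_neg (A : Matrix m m (Quaternion ℝ)) : Phi (-A) = -Phi A := by
  rw [Phi, Phi, fromBlocks_neg]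
  congr 1

/-- The first complex coordinate of a quaternion. -/
noncomputable def quatFst : Quaternion ℝ →+ ℂ where
  toFun q := ⟨q.re, q.imI⟩
  map_zero' := rfl
  map_add' _ _ := rfl

/-- The second complex coordinate of a quaternion. -/
noncomputable def quatSnd : Quaternion ℝ →+ ℂ where
  toFun q := ⟨q.imJ, q.imK⟩
  map_zero' := rfl
  map_add' _ _ := rfl

@[simp] lemma quatFst_re (q : Quaternion ℝ) : (quatFst q).re = q.re := rfl

@[simp] lemma quatFst_im (q : Quaternion ℝ) : (quatFst q).im = q.imI := rfl

@[simp] lemma quatSnd_re (q : Quaternion ℝ) : (quatSnd q).re = q.imJ := rfl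

@[simp] lemma quatSnd_im (q : Quaternion ℝ) : (quatSnd q).im = q.imK := rfl

lemma quatFst_mul (p q : Quaternion ℝ) :
    quatFst (p * q) = quatFst p * quatFst q - quatSnd p * starRingEnd ℂ (quatSnd q) := by
  apply Complex.ext <;> simp <;> ring

lemma quatSnd_mul (p q : Quaternion ℝ) :
    quatSnd (p * q) = quatFst p * quatSnd q + quatSnd p * starRingEnd ℂ (quatFst q) := by
  apply Complex.ext <;> simp <;> ring

lemma Phi_mul (A B : Matrix m m (Quaternion ℝ)) : Phi (A * B) = Phi A * Phi B := by
  have hPhi (C : Matrix m m (Quaternion ℝ)) : Phi C = fromBlocks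
      (of fun k l => quatFst (C k l)) (of fun k l => quatSnd (C k l))
      (-(of fun k l => starRingEnd ℂ (quatSnd (C k l))))
      (of fun k l => starRingEnd ℂ (quatFst (C k l))) := rfl
  simp only [hPhi, fromBlocks_multiply]
  congr 1 <;> ext k l <;>
    simp only [mul_apply, of_apply, map_sum, quatFst_mul, quatSnd_mul, map_sub, map_add, map_mul,
      Matrix.add_apply, Matrix.neg_apply, ← Finset.sum_add_distrib, ← Finset.sum_neg_distrib,
      Complex.conj_conj] <;>
    exact Finset.sum_congr rfl fun i _ => by ring

lemma star_mulVec_eq (Y : Matrix ι ι ℂ) (v : ι → ℂ) :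
    star (Y *ᵥ v) = Y.map (starRingEnd ℂ) *ᵥ star v := by
  ext i
  simp [mulVec, dotProduct]

lemma J_mulVec_star_J_mulVec_star (v : m ⊕ m → ℂ) :
    J m ℂ *ᵥ star (J m ℂ *ᵥ star v) = -v := by
  rw [star_mulVec_eq, J_map_conj, star_star, mulVec_mulVec, J_squared, neg_mulVec, one_mulVec]

lemma mulVec_J_mulVec_star {Y : Matrix (m ⊕ m) (m ⊕ m) ℂ} (h : quatConj Y = Y)
    (v : m ⊕ m → ℂ) : Y *ᵥ (J m ℂ *ᵥ star v) = J m ℂ *ᵥ star (Y *ᵥ v) := by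
  rw [star_mulVec_eq, mulVec_mulVec, mulVec_mulVec, J_mul_conj, h]

/-- A quaternionic involution has determinant one. -/
lemma det_eq_one_of_quatConj_of_sq {G : Matrix (m ⊕ m) (m ⊕ m) ℂ} (hG : quatConj G = G)
    (hsq : G * G = 1) : G.det = 1 := by
  let W : Submodule ℂ (m ⊕ m → ℂ) := LinearMap.ker (toLin' G + 1)
  have hmem (v : m ⊕ m → ℂ) : v ∈ W ↔ G *ᵥ v = -v := by
    simp [W, LinearMap.mem_ker, add_eq_zero_iff_eq_neg]
  have heven : Even (Module.finrank ℂ W) := by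
    refine even_finrank_of_antilinear_sq_eq_neg_one W (J m ℂ) (fun v hv => ?_)
      fun v _ => J_mulVec_star_J_mulVec_star v
    rw [hmem] at hv ⊢
    rw [mulVec_J_mulVec_star hG, hv, star_neg, mulVec_neg]
  have hW : W ≤ W.comap (toLin' G) := fun v hv => by
    have := hv
    rw [hmem] at hv
    rw [Submodule.mem_comap, toLin'_apply, hv]
    exact W.neg_mem this
  have h₁ : (toLin' G).restrict (p := W) (q := W) hW = (-1 : ℂ) • LinearMap.id := by
    ext1 v
    refine Subtype.ext ?_
    simpa using (hmem v).1 v.2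
  have h₂ : W.mapQ W (toLin' G) hW = LinearMap.id := by
    ext1
    refine LinearMap.ext fun v => ?_
    simp only [LinearMap.comp_apply, Submodule.mkQ_apply, Submodule.mapQ_apply, LinearMap.id_apply]
    rw [Submodule.Quotient.eq, hmem, toLin'_apply, mulVec_sub, mulVec_mulVec, hsq, one_mulVec,
      neg_sub]
  rw [← LinearMap.det_toLin', LinearMap.det_eq_det_mul_det W _ hW, h₁, h₂, LinearMap.det_smul,
    LinearMap.det_id, LinearMap.det_id, heven.neg_one_pow, one_mul, one_mul]

end QuaternionicStructure

section RealElements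

variable {m : Type*} [Fintype m] [DecidableEq m] {P A g : Matrix (m ⊕ m) (m ⊕ m) ℂ}
  {D : m ⊕ m → ℂ}

/-- A quaternionic involution anticommuting with `A` forces the imaginary eigenspaces of `A` to be
even-dimensional. -/
lemma even_kerDim_of_involution (hA : quatConj A = A) (hg : quatConj g = g) (hsq : g * g = 1)
    (hgA : g * A = -A * g) {μ : ℂ} (hμ : μ.re = 0) : Even (kerDim (A - μ • 1)) := by
  have hmem (v : m ⊕ m → ℂ) :
      v ∈ LinearMap.ker (A - μ • 1).mulVecLin ↔ A *ᵥ v = μ • v := by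
    simp [LinearMap.mem_ker, sub_eq_zero]
  have hμ' : star μ = -μ := by apply Complex.ext <;> simp [hμ]
  have hT (v : m ⊕ m → ℂ) : (g * J m ℂ) *ᵥ star v = g *ᵥ (J m ℂ *ᵥ star v) := by
    rw [mulVec_mulVec]
  refine even_finrank_of_antilinear_sq_eq_neg_one _ (g * J m ℂ) (fun v hv => ?_) fun v _ => ?_
  · rw [hmem] at hv ⊢
    have hgv : A *ᵥ (g *ᵥ v) = -μ • (g *ᵥ v) := by
      rw [mulVec_mulVec, ← neg_neg (A * g), ← Matrix.neg_mul, ← hgA, neg_mulVec, ← mulVec_mulVec,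
        hv, mulVec_smul, neg_smul]
    rw [hT, mulVec_J_mulVec_star hg, mulVec_J_mulVec_star hA, hgv, star_smul, star_neg, hμ',
      neg_neg, mulVec_smul]
  · rw [hT v, hT, mulVec_J_mulVec_star hg, mulVec_mulVec _ g g, hsq, one_mulVec,
      J_mulVec_star_J_mulVec_star]

lemma quatConj_diagCalc (hP : IsUnit P) (hA : A = P * diagonal D * P⁻¹) (hAc : quatConj A = A)
    (f : ℂ → ℂ) :
    quatConj (diagCalc P D f) = diagCalc P D (fun z => starRingEnd ℂ (f (starRingEnd ℂ z))) := by
  set Q : Matrix (m ⊕ m) (m ⊕ m) ℂ := quatConj P * J m ℂ with hQ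
  have hJ : IsUnit (J m ℂ) := (isUnit_iff_isUnit_det _).2 (isUnit_det_J m ℂ)
  have hP' : P * P⁻¹ = 1 := mul_nonsing_inv P ((isUnit_iff_isUnit_det P).1 hP)
  have hPQ : quatConj P * quatConj P⁻¹ = 1 := by rw [← quatConj_mul, hP', quatConj_one]
  have hQu : IsUnit Q :=
    ((isUnit_iff_isUnit_det _).2 (isUnit_det_of_right_inverse hPQ)).mul hJ
  have hQi : Q⁻¹ = -(J m ℂ * quatConj P⁻¹) := by
    rw [hQ, Matrix.mul_inv_rev, J_inv, inv_eq_right_inv hPQ, Matrix.neg_mul]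
  have hconj (E : m ⊕ m → ℂ) : quatConj (P * diagonal E * P⁻¹)
      = Q * diagonal (fun i => starRingEnd ℂ (E i)) * Q⁻¹ := by
    have hd : quatConj (diagonal E)
        = -(J m ℂ * diagonal (fun i => starRingEnd ℂ (E i)) * J m ℂ) := by
      rw [quatConj, diagonal_map (map_zero _)]
    rw [quatConj_mul, quatConj_mul, hd, hQi, hQ]
    simp only [Matrix.mul_assoc, Matrix.mul_neg, Matrix.neg_mul]
  have hAQ : A = Q * diagonal (fun i => starRingEnd ℂ (D i)) * Q⁻¹ := by
    rw [← hconj, ← hA, hAc]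
  have h := mul_diagCalc_comm (Y := 1) hP hQu
    (by rw [Matrix.one_mul, Matrix.mul_one, ← hA, ← hAQ])
    (fun z => starRingEnd ℂ (f (starRingEnd ℂ z)))
  rw [Matrix.one_mul, Matrix.mul_one] at h
  rw [h, diagCalc, diagCalc, hconj]
  simp only [Complex.conj_conj]

/-- On the sum of the eigenspaces with purely imaginary eigenvalue in the upper half plane, there is
an antilinear map squaring to `-1`; composed with the quaternionic structure it gives a linear map
from the conjugate eigenspaces. -/
lemma exists_imaginary_swap (hP : IsUnit P) (hA : A = P * diagonal D * P⁻¹) (hAc : quatConj A = A)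
    (S : ℂ → Prop) [dS : DecidablePred S] (hS : ∀ z, S z → z.re = 0)
    (heven : ∀ μ, S μ → Even (kerDim (A - μ • 1))) :
    ∃ N, diagCalc P D (fun z => if S z then 1 else 0) * N = N ∧
      N * quatConj (diagCalc P D (fun z => if S z then 1 else 0)) = N ∧
      N * quatConj N = diagCalc P D (fun z => if S z then 1 else 0) ∧
      N * A = -A * N := by
  obtain ⟨T, hTc, hTT, hTD⟩ := exists_fibrewise_sqrt_neg_one D S fun μ hμ => by
    rw [← kerDim_diag_sub_smul hP, ← hA]
    exact heven μ hμ
  have hP'' : P⁻¹ * P = 1 := nonsing_inv_mul P ((isUnit_iff_isUnit_det P).1 hP)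
  have hc : P⁻¹.map (starRingEnd ℂ) * P.map (starRingEnd ℂ) = 1 := by
    rw [← Matrix.map_mul, hP'', Matrix.map_one _ (map_zero _) (map_one _)]
  set e : m ⊕ m → ℂ := fun i => if S (D i) then 1 else 0 with he
  have hE : diagCalc P D (fun z => if S z then 1 else 0) = P * diagonal e * P⁻¹ := rfl
  have hec : (diagonal e).map (starRingEnd ℂ) = diagonal e := by
    rw [diagonal_map (map_zero _)]
    congr 1
    ext i
    simp [he, apply_ite]
  have heT : diagonal e * T = T := by
    ext i j
    rw [diagonal_mul]
    by_cases h : T i j = 0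
    · simp [h]
    · simp [he, (hTD i j h).2]
  have hTe : T * diagonal e = T := by
    ext i j
    rw [mul_diagonal]
    by_cases h : T i j = 0
    · simp [h]
    · simp [he, ← (hTD i j h).1, (hTD i j h).2]
  have hTDc : T * (diagonal D).map (starRingEnd ℂ) = -(diagonal D * T) := by
    ext i j
    rw [diagonal_map (map_zero _), mul_diagonal, Matrix.neg_apply, diagonal_mul]
    by_cases h : T i j = 0
    · simp [h]
    · have hr : starRingEnd ℂ (D j) = -D i := by
        rw [← (hTD i j h).1]
        apply Complex.ext <;> simp [hS _ (hTD i j h).2]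
      rw [hr]
      ring
  set M : Matrix (m ⊕ m) (m ⊕ m) ℂ := P * T * P⁻¹.map (starRingEnd ℂ) with hM
  have hMc (Z : Matrix (m ⊕ m) (m ⊕ m) ℂ) :
      M * (P * Z * P⁻¹).map (starRingEnd ℂ)
        = P * (T * Z.map (starRingEnd ℂ)) * P⁻¹.map (starRingEnd ℂ) := by
    rw [Matrix.map_mul, Matrix.map_mul, hM]
    calc _ = P * T * (P⁻¹.map (starRingEnd ℂ) * P.map (starRingEnd ℂ)) * Z.map (starRingEnd ℂ)
          * P⁻¹.map (starRingEnd ℂ) := by simp only [Matrix.mul_assoc]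
      _ = _ := by rw [hc, Matrix.mul_one, Matrix.mul_assoc P]
  have hZM (Z : Matrix (m ⊕ m) (m ⊕ m) ℂ) :
      P * Z * P⁻¹ * M = P * (Z * T) * P⁻¹.map (starRingEnd ℂ) := by
    calc _ = P * Z * (P⁻¹ * P) * T * P⁻¹.map (starRingEnd ℂ) := by
          simp only [hM, Matrix.mul_assoc]
      _ = _ := by rw [hP'', Matrix.mul_one, Matrix.mul_assoc P]
  have hMM : M * M.map (starRingEnd ℂ) = -(P * diagonal e * P⁻¹) := by
    have : M.map (starRingEnd ℂ) = P.map (starRingEnd ℂ) * (T * P⁻¹) := by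
      rw [hM, Matrix.map_mul, Matrix.map_mul, conj_map_conj, hTc, Matrix.mul_assoc]
    rw [this, hM]
    calc _ = P * T * (P⁻¹.map (starRingEnd ℂ) * P.map (starRingEnd ℂ)) * (T * P⁻¹) := by
          simp only [Matrix.mul_assoc]
      _ = P * (T * T) * P⁻¹ := by rw [hc, Matrix.mul_one]; simp only [Matrix.mul_assoc]
      _ = _ := by rw [hTT, Matrix.mul_neg, Matrix.neg_mul]
  have hJc (Y : Matrix (m ⊕ m) (m ⊕ m) ℂ) :
      M * J m ℂ * quatConj Y = M * Y.map (starRingEnd ℂ) * J m ℂ := by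
    rw [quatConj, Matrix.mul_neg]
    simp only [Matrix.mul_assoc, J_mul_J_mul, Matrix.mul_neg, neg_neg]
  clear_value M
  refine ⟨M * J m ℂ, ?_, ?_, ?_, ?_⟩
  · rw [hE, ← Matrix.mul_assoc, hZM, heT, ← hM]
  · rw [hJc, hE, hMc, hec, hTe, ← hM]
  · rw [hJc, Matrix.map_mul, J_map_conj, Matrix.mul_assoc, Matrix.mul_assoc, J_squared,
      Matrix.mul_neg, Matrix.mul_one, Matrix.mul_neg, hMM, neg_neg, hE]
  · nth_rewrite 1 [← hAc]
    rw [hJc, hA, hMc, hTDc, Matrix.neg_mul, ← Matrix.mul_assoc, hZM]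
    simp only [Matrix.mul_neg, Matrix.neg_mul]

/-- If the imaginary eigenspaces of a real quaternionic `A` are even-dimensional, then `A` is
conjugate to `-A` by a quaternionic involution. -/
lemma exists_involution_of_even (hP : IsUnit P) (hA : A = P * diagonal D * P⁻¹)
    (hAc : quatConj A = A) (hg : quatConj g = g) (hu : IsUnit g) (hgA : g * A = -A * g)
    (heven : ∀ μ : ℂ, μ.re = 0 → μ ≠ 0 → Even (kerDim (A - μ • 1))) :
    ∃ G, quatConj G = G ∧ G * G = 1 ∧ G * A = -A * G := by
  classical
  have hgi : g * g⁻¹ = 1 := mul_nonsing_inv g ((isUnit_iff_isUnit_det g).1 hu)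
  have hig : g⁻¹ * g = 1 := nonsing_inv_mul g ((isUnit_iff_isUnit_det g).1 hu)
  have hgc : quatConj g⁻¹ = g⁻¹ := by
    refine (inv_eq_right_inv ?_).symm
    nth_rewrite 1 [← hg]
    rw [← quatConj_mul, hgi, quatConj_one]
  have hgiA : g⁻¹ * A = -A * g⁻¹ := by
    calc g⁻¹ * A = -(g⁻¹ * (-A * g) * g⁻¹) := by
          simp only [Matrix.mul_assoc, Matrix.neg_mul, Matrix.mul_neg, hgi, Matrix.mul_one, neg_neg]
      _ = -((g⁻¹ * g) * A * g⁻¹) := by rw [← hgA]; simp only [Matrix.mul_assoc]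
      _ = _ := by rw [hig, Matrix.one_mul, Matrix.neg_mul]
  let E (S : ℂ → Prop) : Matrix (m ⊕ m) (m ⊕ m) ℂ := diagCalc P D fun z => if S z then 1 else 0
  have hEE (S S' : ℂ → Prop) (h : ∀ z, S z → ¬ S' z) : E S * E S' = 0 := by
    rw [diagCalc_mul hP, ← diagCalc_zero (P := P) (D := D)]
    congr 1
    ext z
    by_cases hz : S z <;> simp [hz, h]
  have hE_self (S : ℂ → Prop) : E S * E S = E S := by
    rw [diagCalc_mul hP]
    congr 1
    ext z
    simp
  have hEσ (S S' : ℂ → Prop) (h : ∀ z, S' z ↔ S (starRingEnd ℂ z)) :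
      quatConj (E S) = E S' := by
    rw [quatConj_diagCalc hP hA hAc]
    congr 1
    ext z
    simp [h, apply_ite]
  have hneg : -A = P * diagonal (fun i => -D i) * P⁻¹ := by
    rw [← diagonal_neg, Matrix.mul_neg, Matrix.neg_mul, hA]
  have hEneg (Y : Matrix (m ⊕ m) (m ⊕ m) ℂ) (hY : Y * A = -A * Y) (S S' : ℂ → Prop)
      (h : ∀ z, S' z ↔ S (-z)) : Y * E S = E S' * Y := by
    rw [mul_diagCalc_comm (D' := fun i => -D i) hP hP (by rw [← hneg, ← hA, hY])]
    simp only [E, diagCalc, h]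
  have hEA (S : ℂ → Prop) : E S * A = A * E S :=
    (mul_diagCalc_comm hP hP (by rw [hA]) _).symm
  let R₁ : ℂ → Prop := fun z => 0 < z.re
  let R₂ : ℂ → Prop := fun z => z.re < 0
  let R₀ : ℂ → Prop := fun z => z = 0
  let I₁ : ℂ → Prop := fun z => z.re = 0 ∧ 0 < z.im
  let I₂ : ℂ → Prop := fun z => z.re = 0 ∧ z.im < 0
  have hsum : E R₁ + E R₂ + E R₀ + E I₁ + E I₂ = 1 := by
    simp only [E, diagCalc_add]
    rw [← diagCalc_one hP (D := D)]
    congr 1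
    ext z
    simp only [R₁, R₂, R₀, I₁, I₂, Complex.ext_iff, Complex.zero_re, Complex.zero_im]
    rcases lt_trichotomy z.re 0 with h | h | h
    · simp [h, h.ne, h.not_gt]
    · rcases lt_trichotomy z.im 0 with h' | h' | h'
      · simp [h, h', h'.ne, h'.not_gt]
      · simp [h, h']
      · simp [h, h', h'.ne', h'.not_gt]
    · simp [h, h.ne', h.not_gt]
  have hE0A : E R₀ * A = 0 := by
    have : A = diagCalc P D id := hA
    rw [this, diagCalc_mul hP, ← diagCalc_zero (P := P) (D := D)]
    congr 1
    ext z
    simp [R₀]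
  obtain ⟨N, hN₁, hN₂, hNN, hNA⟩ := exists_imaginary_swap hP hA hAc I₁
    (dS := fun _ => Classical.propDecidable _) (fun z hz => hz.1)
    fun μ hμ => heven μ hμ.1 (by rintro rfl; exact lt_irrefl _ hμ.2)
  change E I₁ * N = N at hN₁
  change N * quatConj N = E I₁ at hNN
  change N * quatConj (E I₁) = N at hN₂
  have hI : quatConj (E I₁) = E I₂ := hEσ _ _ fun z => by simp [I₁, I₂]
  have hI' : quatConj (E I₂) = E I₁ := by rw [← hI, quatConj_quatConj]
  rw [hI] at hN₂
  have hR₁ : quatConj (E R₁) = E R₁ := hEσ _ _ fun z => by simp [R₁]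
  have hR₂ : quatConj (E R₂) = E R₂ := hEσ _ _ fun z => by simp [R₂]
  have hR₀ : quatConj (E R₀) = E R₀ := hEσ _ _ fun z => by simp [R₀]
  have hg₁ : g * E R₁ = E R₂ * g := hEneg g hgA _ _ fun z => by simp [R₁, R₂]
  have hg₂ : g⁻¹ * E R₂ = E R₁ * g⁻¹ := hEneg _ hgiA _ _ fun z => by simp [R₁, R₂]
  clear_value E
  refine ⟨g * E R₁ + g⁻¹ * E R₂ + E R₀ + N + quatConj N, ?_, ?_, ?_⟩
  · simp only [quatConj_add, quatConj_mul, quatConj_quatConj, hg, hgc, hR₁, hR₂, hR₀]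
    abel
  · refine mul_self_eq_one_of_partial_inverses hsum
      ?_ ?_ ?_ ?_ ?_ ?_ ?_ ?_ ?_ ?_ ?_ ?_ ?_ ?_ ?_ ?_ ?_ ?_ ?_ ?_ (hE_self _)
      ?_ ?_ ?_ ?_ hN₂ hN₁ ?_ ?_ ?_ ?_ hNN ?_
    iterate 20
      · exact hEE _ _ fun z h h' => by
          simp only [R₁, R₂, R₀, I₁, I₂, Complex.ext_iff, Complex.zero_re, Complex.zero_im] at h h'
          grind
    · rw [Matrix.mul_assoc, hE_self]
    · rw [hg₁, ← Matrix.mul_assoc, hE_self]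
    · rw [Matrix.mul_assoc, hE_self]
    · rw [hg₂, ← Matrix.mul_assoc, hE_self]
    · rw [← hI', ← quatConj_mul, hN₂]
    · rw [← hI, ← quatConj_mul, hN₁]
    · rw [hg₁, hg₂, Matrix.mul_assoc, ← Matrix.mul_assoc g, ← Matrix.mul_assoc, hg₁]
      rw [Matrix.mul_assoc, Matrix.mul_assoc, hgi, Matrix.mul_one, hE_self]
    · rw [hg₁, hg₂, Matrix.mul_assoc, ← Matrix.mul_assoc g⁻¹, hg₂, Matrix.mul_assoc, hig,
        Matrix.mul_one, hE_self]
    · nth_rewrite 2 [← quatConj_quatConj N]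
      rw [← quatConj_mul, hNN, hI]
  · have hN'A : quatConj N * A = -A * quatConj N := by
      nth_rewrite 1 [← hAc]
      rw [← quatConj_mul, hNA, quatConj_mul, quatConj_neg, hAc]
    have hAE0 : A * E R₀ = 0 := by rw [← hEA, hE0A]
    simp only [Matrix.add_mul, Matrix.mul_add, hNA, hN'A, hE0A, Matrix.neg_mul, hAE0, neg_zero,
      Matrix.mul_assoc, hEA]
    simp only [← Matrix.mul_assoc, hgA, hgiA, Matrix.neg_mul]

end RealElements

/-- a semisimple Ad_{SL(n,ℍ)}-real X ∈ sl(n,ℍ) is strongly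
Ad_{SL(n,ℍ)}-real iff every nonzero purely imaginary eigenvalue class has even
multiplicity. -/
theorem semisimple_strongly_adSL_real_iff_quaternion (n : ℕ) (hn : 1 ≤ n)
    (X : Matrix (Fin n) (Fin n) (Quaternion ℝ)) (htr : (Phi X).trace = 0)
    (hdiag : ∃ (P : Matrix (Fin n ⊕ Fin n) (Fin n ⊕ Fin n) ℂ)
        (D : (Fin n ⊕ Fin n) → ℂ), IsUnit P ∧ Phi X = P * Matrix.diagonal D * P⁻¹)
    (hreal : ∃ g : Matrix (Fin n) (Fin n) (Quaternion ℝ),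
        (Phi g).det = 1 ∧ g * X = -X * g) :
    (∃ g : Matrix (Fin n) (Fin n) (Quaternion ℝ),
        g * g = 1 ∧ (Phi g).det = 1 ∧ g * X = -X * g) ↔
      (∀ μ : ℂ, μ.re = 0 → μ ≠ 0 → Even (kerDim (Phi X - μ • 1))) := by
  have hPhi {g : Matrix (Fin n) (Fin n) (Quaternion ℝ)} (h : g * X = -X * g) :
      Phi g * Phi X = -Phi X * Phi g := by
    rw [← Phi_mul, h, Phi_mul, Phi_neg]
  constructor
  · rintro ⟨g, hsq, -, hgX⟩ μ hμ -
    exact even_kerDim_of_involution (quatConj_Phi X) (quatConj_Phi g)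
      (by rw [← Phi_mul, hsq, Phi_one]) (hPhi hgX) hμ
  · intro heven
    obtain ⟨P, D, hP, hX⟩ := hdiag
    obtain ⟨g, hdet, hgX⟩ := hreal
    have hu : IsUnit (Phi g) := (isUnit_iff_isUnit_det _).2 (by rw [hdet]; exact isUnit_one)
    obtain ⟨G, hGc, hGG, hGX⟩ := exists_involution_of_even hP hX (quatConj_Phi X) (quatConj_Phi g)
      hu (hPhi hgX) heven
    obtain ⟨h, rfl⟩ := exists_Phi_eq hGc
    refine ⟨h, Phi_injective ?_, det_eq_one_of_quatConj_of_sq hGc hGG, Phi_injective ?_⟩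
    · rw [Phi_mul, hGG, Phi_one]
    · rw [Phi_mul, hGX, Phi_mul, Phi_neg]
end

section
/- Let n ≥ 1 and let a > 0 be a real number. Let X ∈ M(n,ℍ) be the quaternionic Jordan block J(n, a·i): the diagonal entries of X equal a·i (where i is the imaginary quaternion unit), the superdiagonal entries X k (k+1) equal 1, and all other entries are 0. Then there is no matrix g ∈ M(n,ℍ) with g · g = 1 and g · X = −X · g. In particular, X is not strongly Ad_{SL(n,ℍ)}-real. -/
/-- Left multiplication by a Jordan block scales each row and adds the row below. -/
theorem jordan_block_mul_apply {n : ℕ} {c : Quaternion ℝ}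
    {X : Matrix (Fin n) (Fin n) (Quaternion ℝ)}
    (hX : ∀ k l : Fin n, X k l = if k = l then c else if (l : ℕ) = (k : ℕ) + 1 then 1 else 0)
    (g : Matrix (Fin n) (Fin n) (Quaternion ℝ)) (k m : Fin n) :
    (X * g) k m = c * g k m + if h : (k : ℕ) + 1 < n then g ⟨k + 1, h⟩ m else 0 := by
  have hsplit : ∀ l : Fin n, X k l * g l m =
      (if k = l then c * g l m else 0) + if (l : ℕ) = (k : ℕ) + 1 then g l m else 0 := by
    intro l
    rw [hX]
    by_cases h : k = l
    · subst h
      simp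
    · by_cases h' : (l : ℕ) = (k : ℕ) + 1 <;> simp [h, h']
  rw [Matrix.mul_apply, Finset.sum_congr rfl fun l _ => hsplit l, Finset.sum_add_distrib,
    Finset.sum_ite_eq]
  simp only [Finset.mem_univ, if_true]
  congr 1
  split_ifs with h
  · rw [Finset.sum_eq_single (⟨k + 1, h⟩ : Fin n)]
    · simp
    · intro l _ hl
      exact if_neg fun h' => hl (Fin.ext h')
    · simp
  · refine Finset.sum_eq_zero fun l _ => if_neg fun h' => h ?_
    rw [← h']
    exact l.isLt

/-- The first column of a product with a Jordan block on the right. -/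
theorem mul_jordan_block_apply_zero {n : ℕ} {c : Quaternion ℝ}
    {X : Matrix (Fin n) (Fin n) (Quaternion ℝ)}
    (hX : ∀ k l : Fin n, X k l = if k = l then c else if (l : ℕ) = (k : ℕ) + 1 then 1 else 0)
    (g : Matrix (Fin n) (Fin n) (Quaternion ℝ)) (k : Fin n) (hn : 0 < n) :
    (g * X) k ⟨0, hn⟩ = g k ⟨0, hn⟩ * c := by
  rw [Matrix.mul_apply, Finset.sum_eq_single (⟨0, hn⟩ : Fin n)]
  · simp [hX]
  · intro l _ hl
    simp [hX, hl]
  · simp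

/-- The anticommutator of a quaternion with `a * i` lies in the complex subfield, and it
determines the complex component of that quaternion when `a` is nonzero. -/
theorem components_of_mul_eq_neg_add {a : ℝ} {c p q : Quaternion ℝ} (hc : c = ⟨0, a, 0, 0⟩)
    (h : p * c = -(c * p + q)) :
    q.re = 2 * (a * p.imI) ∧ q.imI = -2 * (a * p.re) ∧ q.imJ = 0 ∧ q.imK = 0 := by
  have hR := congrArg QuaternionAlgebra.re h
  have hI := congrArg QuaternionAlgebra.imI h
  have hJ := congrArg QuaternionAlgebra.imJ h
  have hK := congrArg QuaternionAlgebra.imK h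
  have c1 : c.re = 0 := by rw [hc]
  have c2 : c.imI = a := by rw [hc]
  have c3 : c.imJ = 0 := by rw [hc]
  have c4 : c.imK = 0 := by rw [hc]
  simp only [Quaternion.re_neg, Quaternion.imI_neg, Quaternion.imJ_neg, Quaternion.imK_neg,
    Quaternion.re_add, Quaternion.imI_add, Quaternion.imJ_add, Quaternion.imK_add,
    Quaternion.re_mul, Quaternion.imI_mul, Quaternion.imJ_mul, Quaternion.imK_mul,
    c1, c2, c3, c4] at hR hI hJ hK
  refine ⟨?_, ?_, ?_, ?_⟩ <;> linarith

/-- the quaternionic Jordan block J(n, a·i) with a > 0 is not reversed by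
any involution of M(n,ℍ); in particular it is not strongly Ad_{SL(n,ℍ)}-real. -/
theorem jordan_block_not_strongly_real (n : ℕ) (hn : 1 ≤ n) (a : ℝ) (ha : 0 < a)
    (X : Matrix (Fin n) (Fin n) (Quaternion ℝ))
    (hX : ∀ k l : Fin n, X k l =
      if k = l then (⟨0, a, 0, 0⟩ : Quaternion ℝ)
      else if (l : ℕ) = (k : ℕ) + 1 then 1 else 0) :
    ¬ ∃ g : Matrix (Fin n) (Fin n) (Quaternion ℝ), g * g = 1 ∧ g * X = -X * g := by
  rintro ⟨g, hg, hgX⟩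
  obtain ⟨c, hc⟩ : ∃ c : Quaternion ℝ, c = ⟨0, a, 0, 0⟩ := ⟨_, rfl⟩
  rw [← hc] at hX
  set z : Fin n := ⟨0, hn⟩
  have key (k : Fin n) : g k z * c =
      -(c * g k z + if h : (k : ℕ) + 1 < n then g ⟨k + 1, h⟩ z else 0) := by
    rw [← jordan_block_mul_apply hX, ← mul_jordan_block_apply_zero hX g k hn, hgX,
      Matrix.neg_mul, Matrix.neg_apply]
  have hlow (k : ℕ) (h : k + 1 < n) : (g ⟨k + 1, h⟩ z).imJ = 0 ∧ (g ⟨k + 1, h⟩ z).imK = 0 := by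
    have hk := key ⟨k, by omega⟩
    simp only [h, dif_pos] at hk
    exact (components_of_mul_eq_neg_add hc hk).2.2
  have hup (d k : ℕ) (h : k < n) (hd : n = k + 1 + d) :
      (g ⟨k, h⟩ z).re = 0 ∧ (g ⟨k, h⟩ z).imI = 0 := by
    induction d generalizing k with
    | zero =>
      have hk := key ⟨k, h⟩
      have h' : ¬ k + 1 < n := by omega
      simp only [h', dif_neg, not_false_eq_true] at hk
      obtain ⟨hI, hR, -⟩ := components_of_mul_eq_neg_add hc hk
      rw [Quaternion.re_zero] at hI
      rw [Quaternion.imI_zero] at hR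
      constructor <;> apply mul_left_cancel₀ ha.ne' <;> linarith
    | succ d ih =>
      have h' : k + 1 < n := by omega
      obtain ⟨h1, h2⟩ := ih (k + 1) h' (by omega)
      have hk := key ⟨k, h⟩
      simp only [h', dif_pos] at hk
      obtain ⟨hI, hR, -⟩ := components_of_mul_eq_neg_add hc hk
      constructor <;> apply mul_left_cancel₀ ha.ne' <;> linarith
  have hcol (l : Fin n) (hl : l ≠ z) : g l z = 0 := by
    obtain ⟨l, hln⟩ := l
    obtain _ | k := l
    · exact absurd rfl hl
    · obtain ⟨h1, h2⟩ := hup (n - (k + 1 + 1)) (k + 1) hln (by omega)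
      obtain ⟨h3, h4⟩ := hlow k hln
      exact QuaternionAlgebra.ext h1 h2 h3 h4
  have hsq : g z z * g z z = 1 := by
    have h := congrFun (congrFun hg z) z
    rwa [Matrix.mul_apply, Finset.sum_eq_single z (fun l _ hl => by rw [hcol l hl, mul_zero])
      (by simp), Matrix.one_apply_eq] at h
  obtain ⟨h1, h2⟩ := hup (n - 1) 0 hn (by omega)
  have hre := congrArg QuaternionAlgebra.re hsq
  change (g z z).re = 0 at h1
  change (g z z).imI = 0 at h2
  rw [Quaternion.re_mul, h1, h2, Quaternion.re_one] at hre
  nlinarith [mul_self_nonneg (g z z).imJ, mul_self_nonneg (g z z).imK]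
end

section
/- Let n ≥ 1 and let a > 0 be a real number. Let J ∈ M(n,ℍ) be the quaternionic Jordan block J(n, a·i) (diagonal entries a·i, superdiagonal entries 1, all other entries 0, where i is the imaginary quaternion unit), and let X be the block diagonal matrix J ⊕ J, indexed by Fin n ⊕ Fin n. Then there exists g ∈ M(2n,ℍ) with g · g = 1, det(Φ(g)) = 1, and g · X = −X · g. That is, X is strongly Ad_{SL(2n,ℍ)}-real. -/
open scoped Quaternion

/-- The symplectic block matrix `[[0, 1], [-1, 0]]` has determinant one. -/
theorem det_fromBlocks_zero_one_neg_one_zero {m R : Type*} [Fintype m] [DecidableEq m]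
    [CommRing R] :
    (Matrix.fromBlocks 0 1 (-1) 0 : Matrix (m ⊕ m) (m ⊕ m) R).det = 1 := by
  have h : (Matrix.fromBlocks 0 1 (-1) 0 : Matrix (m ⊕ m) (m ⊕ m) R) =
      Matrix.fromBlocks 1 1 0 1 * Matrix.fromBlocks 1 0 (-1) 1 * Matrix.fromBlocks 1 1 0 1 := by
    simp [Matrix.fromBlocks_multiply]
  rw [h, Matrix.det_mul, Matrix.det_mul]
  simp

theorem det_fromBlocks_zero_neg_zero {m R : Type*} [Fintype m] [DecidableEq m]
    [CommRing R] (B : Matrix m m R) :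
    (Matrix.fromBlocks 0 B (-B) 0).det = (B * B).det := by
  have h : Matrix.fromBlocks 0 B (-B) 0 =
      Matrix.fromBlocks 0 1 (-1) 0 * Matrix.fromBlocks B 0 0 B := by
    simp [Matrix.fromBlocks_multiply]
  rw [h, Matrix.det_mul, det_fromBlocks_zero_one_neg_one_zero, Matrix.det_fromBlocks_zero₂₁,
    Matrix.det_mul, one_mul]

/-- The diagonal matrix with alternating signs. -/
def alternatingDiagonal (n : ℕ) (R : Type*) [Ring R] : Matrix (Fin n) (Fin n) R :=
  Matrix.diagonal fun k => (-1) ^ (k : ℕ)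

theorem alternatingDiagonal_mul_self (n : ℕ) (R : Type*) [Ring R] :
    alternatingDiagonal n R * alternatingDiagonal n R = 1 := by
  rw [alternatingDiagonal, Matrix.diagonal_mul_diagonal, ← Matrix.diagonal_one]
  congr 1
  funext k
  exact pow_mul_pow_eq_one _ (by simp)

/-- The quaternion `(-1) ^ k * j`. -/
noncomputable def signedJ (k : ℕ) : Quaternion ℝ := ⟨0, 0, (-1) ^ k, 0⟩

@[simp] theorem signedJ_re (k : ℕ) : (signedJ k).re = 0 := rfl

@[simp] theorem signedJ_imI (k : ℕ) : (signedJ k).imI = 0 := rfl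

@[simp] theorem signedJ_imJ (k : ℕ) : (signedJ k).imJ = (-1) ^ k := rfl

@[simp] theorem signedJ_imK (k : ℕ) : (signedJ k).imK = 0 := rfl

/-- The diagonal matrix with entries `(-1) ^ k * j`. -/
noncomputable def alternatingJ (n : ℕ) : Matrix (Fin n) (Fin n) (Quaternion ℝ) :=
  Matrix.diagonal fun k => signedJ k

theorem alternatingJ_mul_self (n : ℕ) : alternatingJ n * alternatingJ n = -1 := by
  rw [alternatingJ, Matrix.diagonal_mul_diagonal, ← Matrix.diagonal_one, Matrix.diagonal_neg]
  congr 1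
  funext k
  ext <;> simp [← mul_pow]

theorem Phi_fromBlocks_alternatingJ (n : ℕ) :
    Phi (Matrix.fromBlocks 0 (alternatingJ n) (-alternatingJ n) 0) =
      Matrix.fromBlocks 0
        (Matrix.fromBlocks 0 (alternatingDiagonal n ℂ) (-alternatingDiagonal n ℂ) 0)
        (-Matrix.fromBlocks 0 (alternatingDiagonal n ℂ) (-alternatingDiagonal n ℂ) 0) 0 := by
  have hre (k l : Fin n) : (alternatingJ n k l).re = 0 := by
    by_cases h : k = l <;> simp [alternatingJ, h]
  have hi (k l : Fin n) : (alternatingJ n k l).imI = 0 := by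
    by_cases h : k = l <;> simp [alternatingJ, h]
  have hk (k l : Fin n) : (alternatingJ n k l).imK = 0 := by
    by_cases h : k = l <;> simp [alternatingJ, h]
  have hj (k l : Fin n) :
      (((alternatingJ n k l).imJ : ℝ) : ℂ) = alternatingDiagonal n ℂ k l := by
    by_cases h : k = l <;>
      simp [alternatingJ, alternatingDiagonal, h]
  have hjr (k l : Fin n) : (alternatingDiagonal n ℂ k l).re = (alternatingJ n k l).imJ := by
    rw [← hj, Complex.ofReal_re]
  have hji (k l : Fin n) : (alternatingDiagonal n ℂ k l).im = 0 := by
    rw [← hj, Complex.ofReal_im]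
  ext (k | k) (l | l)
  all_goals
    rcases k with k | k <;> rcases l with l | l <;>
      apply Complex.ext <;> simp [Phi, hre, hi, hk, hjr, hji]

theorem alternatingJ_mul_jordanBlock (n : ℕ) (a : ℝ)
    (J : Matrix (Fin n) (Fin n) (Quaternion ℝ))
    (hJ : ∀ k l : Fin n, J k l =
      if k = l then (⟨0, a, 0, 0⟩ : Quaternion ℝ)
      else if (l : ℕ) = (k : ℕ) + 1 then 1 else 0) :
    alternatingJ n * J = -(J * alternatingJ n) := by
  ext1 k l
  rw [Matrix.neg_apply, alternatingJ, Matrix.diagonal_mul, Matrix.mul_diagonal]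
  have hkl := hJ k l
  split_ifs at hkl with h h'
  · subst h
    have hre : (J k k).re = 0 := congrArg QuaternionAlgebra.re hkl
    have hi : (J k k).imI = a := congrArg QuaternionAlgebra.imI hkl
    have hj : (J k k).imJ = 0 := congrArg QuaternionAlgebra.imJ hkl
    have hk : (J k k).imK = 0 := congrArg QuaternionAlgebra.imK hkl
    ext <;> simp [hre, hi, hj, hk, mul_comm]
  · have hone : J k l = (1 : ℍ[ℝ]) := hkl
    rw [hone, mul_one, one_mul, h']
    ext <;> simp [pow_succ]
  · have hzero : J k l = (0 : ℍ[ℝ]) := hkl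
    rw [hzero, mul_zero, zero_mul, neg_zero]

/-- the direct sum J(n,a·i) ⊕ J(n,a·i) of two equal quaternionic Jordan
blocks (a > 0) is strongly Ad_{SL(2n,ℍ)}-real. -/
theorem jordan_block_pair_strongly_real (n : ℕ) (hn : 1 ≤ n) (a : ℝ) (ha : 0 < a)
    (J : Matrix (Fin n) (Fin n) (Quaternion ℝ))
    (hJ : ∀ k l : Fin n, J k l =
      if k = l then (⟨0, a, 0, 0⟩ : Quaternion ℝ)
      else if (l : ℕ) = (k : ℕ) + 1 then 1 else 0)
    (X : Matrix (Fin n ⊕ Fin n) (Fin n ⊕ Fin n) (Quaternion ℝ))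
    (hX : X = Matrix.fromBlocks J 0 0 J) :
    ∃ g : Matrix (Fin n ⊕ Fin n) (Fin n ⊕ Fin n) (Quaternion ℝ),
      g * g = 1 ∧ (Phi g).det = 1 ∧ g * X = -X * g := by
  refine ⟨Matrix.fromBlocks 0 (alternatingJ n) (-alternatingJ n) 0, ?_, ?_, ?_⟩
  · simp [Matrix.fromBlocks_multiply, alternatingJ_mul_self]
  · rw [Phi_fromBlocks_alternatingJ, det_fromBlocks_zero_neg_zero, Matrix.det_mul,
      det_fromBlocks_zero_neg_zero, alternatingDiagonal_mul_self, Matrix.det_one, one_mul]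
  · subst hX
    simp [Matrix.fromBlocks_multiply, Matrix.fromBlocks_neg,
      alternatingJ_mul_jordanBlock n a J hJ]
end

section
/- Let n ≥ 1, let a > 0 be a real number, and let N ∈ M(n,ℂ) be a nilpotent complex matrix. Let X ∈ M(n,ℍ) be the quaternionic matrix X = (a·i)·1 + N′, where N′ is N viewed entrywise as a quaternionic matrix via the embedding ℂ ↪ ℍ, 1 is the identity matrix, and i is the imaginary quaternion unit. If there exists g ∈ M(n,ℍ) with g · g = 1 and g · X = −X · g, then t_d(N, 0) is even for every integer d ≥ 1. -/
/-- `tB Y lam d` is the number of Jordan blocks of size `d` with eigenvalue `lam`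
in the Jordan form of `Y`. -/
noncomputable def tB {m : Type*} [Fintype m] [DecidableEq m]
    (Y : Matrix m m ℂ) (lam : ℂ) (d : ℕ) : ℤ :=
  2 * kerDim ((Y - lam • 1) ^ d) - kerDim ((Y - lam • 1) ^ (d - 1))
    - kerDim ((Y - lam • 1) ^ (d + 1))

/-- The quaternion a·i. -/
def aI (a : ℝ) : Quaternion ℝ := ⟨0, a, 0, 0⟩

/-- The embedding ℂ ↪ ℍ onto the span of 1 and i. -/
def cToQ (c : ℂ) : Quaternion ℝ := ⟨c.re, c.im, 0, 0⟩

/-- A finite-dimensional complex vector space carrying a conjugate-linear map of square `-1`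
has even dimension. -/
theorem even_finrank_of_conj_linear_sq_neg {V : Type*} [AddCommGroup V] [Module ℂ V]
    [FiniteDimensional ℂ V] (J : V →ₛₗ[starRingEnd ℂ] V) (hJ : ∀ v, J (J v) = -v) :
    Even (Module.finrank ℂ V) := by
  let b := Module.finBasis ℂ V
  let C : Matrix (Fin (Module.finrank ℂ V)) (Fin (Module.finrank ℂ V)) ℂ :=
    Matrix.of fun i j => b.repr (J (b j)) i
  have hCol (j) : J (b j) = ∑ i, C i j • b i := (b.sum_repr (J (b j))).symm
  have hC : C * C.map (starRingEnd ℂ) = -1 := by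
    ext k j
    have h := congrArg (fun v => b.repr v k) (hJ (b j))
    simp only [hCol j, map_sum, map_smulₛₗ, Finsupp.coe_finsetSum, Finset.sum_apply,
      map_neg, Finsupp.coe_neg, Pi.neg_apply, Module.Basis.repr_self] at h
    rw [Matrix.mul_apply, Matrix.neg_apply, Matrix.one_apply]
    rw [Finsupp.single_apply] at h
    simp only [eq_comm (a := k), ← h]
    refine Finset.sum_congr rfl fun i _ => ?_
    simp [C, mul_comm]
  have hdet := congrArg Matrix.det hC
  have hmap : (C.map (starRingEnd ℂ)).det = starRingEnd ℂ C.det :=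
    ((starRingEnd ℂ).map_det C).symm
  rw [Matrix.det_mul, hmap, Complex.mul_conj, Matrix.det_neg, Matrix.det_one,
    Fintype.card_fin, mul_one] at hdet
  by_contra hodd
  rw [(Nat.not_even_iff_odd.mp hodd).neg_one_pow] at hdet
  have hre : Complex.normSq C.det = -1 := by exact_mod_cast hdet
  linarith [Complex.normSq_nonneg C.det]

/-- If `B * conj B = -1` and `B * conj Y = c • (Y * B)` with `c ≠ 0`, then the kernel of `Y` has
even dimension. -/
theorem even_kerDim_of_conj_intertwine {m : Type*} [Fintype m] [DecidableEq m]
    (B Y : Matrix m m ℂ) (c : ℂ) (hB : B * B.map (starRingEnd ℂ) = -1)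
    (hY : B * Y.map (starRingEnd ℂ) = c • (Y * B)) (hc : c ≠ 0) : Even (kerDim Y) := by
  have hconj (M : Matrix m m ℂ) (v : m → ℂ) :
      star (M.mulVec v) = (M.map (starRingEnd ℂ)).mulVec (star v) := by
    ext i
    simp [Matrix.mulVec, dotProduct]
  have hker (v : LinearMap.ker Y.mulVecLin) :
      B.mulVec (star (v : m → ℂ)) ∈ LinearMap.ker Y.mulVecLin := by
    have hv : Y.mulVec (v : m → ℂ) = 0 := v.2
    have h : c • Y.mulVec (B.mulVec (star (v : m → ℂ))) = 0 := by
      rw [Matrix.mulVec_mulVec, ← Matrix.smul_mulVec, ← hY, ← Matrix.mulVec_mulVec, ← hconj, hv,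
        star_zero, Matrix.mulVec_zero]
    exact (smul_eq_zero.mp h).resolve_left hc
  let J : LinearMap.ker Y.mulVecLin →ₛₗ[starRingEnd ℂ] LinearMap.ker Y.mulVecLin :=
    { toFun := fun v => ⟨B.mulVec (star (v : m → ℂ)), hker v⟩
      map_add' := fun v w => Subtype.ext (by simp [Matrix.mulVec_add])
      map_smul' := fun r v => Subtype.ext (by simp [Matrix.mulVec_smul]) }
  refine even_finrank_of_conj_linear_sq_neg J fun v => Subtype.ext ?_
  change B.mulVec (star (B.mulVec (star (v : m → ℂ)))) = -(v : m → ℂ)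
  rw [hconj, star_star, Matrix.mulVec_mulVec, hB, Matrix.neg_mulVec, Matrix.one_mulVec]

/-- The component `z` in the decomposition `q = z + w j` of a quaternion with `z w : ℂ`. -/
def quaternionFst : Quaternion ℝ →+ ℂ where
  toFun q := ⟨q.re, q.imI⟩
  map_zero' := rfl
  map_add' _ _ := rfl

/-- The component `w` in the decomposition `q = z + w j` of a quaternion with `z w : ℂ`. -/
def quaternionSnd : Quaternion ℝ →+ ℂ where
  toFun q := ⟨q.imJ, q.imK⟩
  map_zero' := rfl
  map_add' _ _ := rfl

theorem quaternionFst_apply (q : Quaternion ℝ) : quaternionFst q = ⟨q.re, q.imI⟩ := rfl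

theorem quaternionSnd_apply (q : Quaternion ℝ) : quaternionSnd q = ⟨q.imJ, q.imK⟩ := rfl

theorem quaternionFst_cToQ (c : ℂ) : quaternionFst (cToQ c) = c := rfl

theorem quaternionSnd_cToQ (c : ℂ) : quaternionSnd (cToQ c) = 0 := rfl

theorem quaternionFst_aI (a : ℝ) : quaternionFst (aI a) = ⟨0, a⟩ := rfl

theorem quaternionSnd_aI (a : ℝ) : quaternionSnd (aI a) = 0 := rfl

theorem quaternionFst_mul (x y : Quaternion ℝ) :
    quaternionFst (x * y) = quaternionFst x * quaternionFst y -
      quaternionSnd x * starRingEnd ℂ (quaternionSnd y) := by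
  apply Complex.ext <;> simp [quaternionFst_apply, quaternionSnd_apply] <;> ring

theorem quaternionSnd_mul (x y : Quaternion ℝ) :
    quaternionSnd (x * y) = quaternionFst x * quaternionSnd y +
      quaternionSnd x * starRingEnd ℂ (quaternionFst y) := by
  apply Complex.ext <;> simp [quaternionFst_apply, quaternionSnd_apply] <;> ring

theorem map_quaternionFst_mul {m : Type*} [Fintype m] (G H : Matrix m m (Quaternion ℝ)) :
    (G * H).map quaternionFst = G.map quaternionFst * H.map quaternionFst -
      G.map quaternionSnd * (H.map quaternionSnd).map (starRingEnd ℂ) := by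
  ext i j : 1
  simp [Matrix.mul_apply, quaternionFst_mul]

theorem map_quaternionSnd_mul {m : Type*} [Fintype m] (G H : Matrix m m (Quaternion ℝ)) :
    (G * H).map quaternionSnd = G.map quaternionFst * H.map quaternionSnd +
      G.map quaternionSnd * (H.map quaternionFst).map (starRingEnd ℂ) := by
  ext i j : 1
  simp [Matrix.mul_apply, quaternionSnd_mul, Finset.sum_add_distrib]

/-- An element intertwining a unit with a nilpotent element vanishes. -/
theorem SemiconjBy.eq_zero_of_isUnit_of_isNilpotent {R : Type*} [Ring R] {x u y : R}
    (h : SemiconjBy x u y) (hu : IsUnit u) (hy : IsNilpotent y) : x = 0 := by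
  obtain ⟨k, hk⟩ := hy
  have hxk : x * u ^ k = 0 := by rw [(h.pow_right k).eq, hk, zero_mul]
  exact (hu.pow k).mul_left_eq_zero.mp hxk

/-- if X = (a·i)·1 + N (N nilpotent complex, a > 0) is reversed by an
involution of GL(n,ℍ), then all multiplicities of the partition of N are even. -/
theorem jordan_form_reverser_even_multiplicities (n : ℕ) (hn : 1 ≤ n)
    (a : ℝ) (ha : 0 < a)
    (N : Matrix (Fin n) (Fin n) ℂ) (hnil : IsNilpotent N)
    (X : Matrix (Fin n) (Fin n) (Quaternion ℝ))
    (hX : X = aI a • (1 : Matrix (Fin n) (Fin n) (Quaternion ℝ)) + N.map cToQ)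
    (hrev : ∃ g : Matrix (Fin n) (Fin n) (Quaternion ℝ), g * g = 1 ∧ g * X = -X * g) :
    ∀ d : ℕ, 1 ≤ d → Even (tB N 0 d) := by
  obtain ⟨g, hgg, hgX⟩ := hrev
  set A := g.map quaternionFst
  set B := g.map quaternionSnd
  set z : ℂ := ⟨0, a⟩
  have hXapp (i j) :
      X i j = aI a * (1 : Matrix (Fin n) (Fin n) (Quaternion ℝ)) i j + cToQ (N i j) := by
    rw [hX]
    rfl
  have hXfst : X.map quaternionFst = z • 1 + N := by
    ext i j
    by_cases hij : i = j <;>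
      simp [hXapp, hij, quaternionFst_aI, quaternionFst_cToQ, z]
  have hXsnd : X.map quaternionSnd = 0 := by
    ext i j
    by_cases hij : i = j <;>
      simp [hXapp, hij, quaternionSnd_aI, quaternionSnd_cToQ]
  have hgX' : g * X + X * g = 0 := by rw [hgX, neg_mul, neg_add_cancel]
  have hA : A * (z • 1 + N) + (z • 1 + N) * A = 0 := by
    have h := congrArg (fun M => M.map quaternionFst) hgX'
    simpa [Matrix.map_add, map_quaternionFst_mul, hXfst, hXsnd, A] using h
  have hB : B * (z • 1 + N).map (starRingEnd ℂ) + (z • 1 + N) * B = 0 := by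
    have h := congrArg (fun M => M.map quaternionSnd) hgX'
    simpa [Matrix.map_add, map_quaternionSnd_mul, hXfst, hXsnd, B] using h
  have hz : z ≠ 0 := fun h => ha.ne' (congrArg Complex.im h)
  have hA0 : A = 0 := by
    have hunit : IsUnit ((2 * z) • (1 : Matrix (Fin n) (Fin n) ℂ) + N) := by
      have hs : IsUnit ((2 * z) • (1 : Matrix (Fin n) (Fin n) ℂ)) := by
        rw [← Algebra.algebraMap_eq_smul_one]
        exact (IsUnit.mk0 _ (mul_ne_zero two_ne_zero hz)).map _
      exact hnil.isUnit_add_left_of_commute hs ((Commute.one_right N).smul_right _)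
    refine SemiconjBy.eq_zero_of_isUnit_of_isNilpotent ?_ hunit hnil.neg
    rw [SemiconjBy, ← sub_eq_zero, ← hA]
    simp only [mul_add, add_mul, neg_mul, mul_smul_comm, smul_mul_assoc, mul_one, one_mul]
    module
  have hBB : B * B.map (starRingEnd ℂ) = -1 := by
    have h := congrArg (fun M => M.map quaternionFst) hgg
    have hone : (1 : Matrix (Fin n) (Fin n) (Quaternion ℝ)).map quaternionFst = 1 :=
      Matrix.map_one _ (map_zero _) rfl
    simp only [map_quaternionFst_mul, hone] at h
    change A * A - B * B.map (starRingEnd ℂ) = 1 at h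
    rw [← h, hA0]
    simp
  have hBN : SemiconjBy B (N.map (starRingEnd ℂ)) (-N) := by
    have hmap : (z • 1 + N).map (starRingEnd ℂ) = -(z • 1) + N.map (starRingEnd ℂ) := by
      ext i j
      by_cases hij : i = j <;> simp [hij, z, Complex.ext_iff]
    rw [hmap] at hB
    rw [SemiconjBy, ← sub_eq_zero, ← hB]
    simp only [mul_add, add_mul, neg_mul, mul_neg, mul_smul_comm, smul_mul_assoc, mul_one, one_mul]
    module
  have heven (k : ℕ) : Even (kerDim (N ^ k)) := by
    refine even_kerDim_of_conj_intertwine B (N ^ k) ((-1) ^ k) hBB ?_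
      (pow_ne_zero _ (neg_ne_zero.mpr one_ne_zero))
    have hpow : (N ^ k).map (starRingEnd ℂ) = N.map (starRingEnd ℂ) ^ k :=
      map_pow (starRingEnd ℂ).mapMatrix N k
    rw [hpow, (hBN.pow_right k).eq, ← neg_one_smul ℂ N, smul_pow, smul_mul_assoc]
  intro d _
  rw [tB, zero_smul, sub_zero]
  exact ((even_two_mul _).sub ((Int.even_coe_nat _).mpr (heven _))).sub
    ((Int.even_coe_nat _).mpr (heven _))
end
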